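/- Let Ω ⊆ ℝ^N be a bounded open set whose topological boundary ∂Ω has Lebesgue measure zero. For every ε > 0 there exists δ > 0 such that for every continuous injective map h : ℝ^N → ℝ^N with sup_{x ∈ ℝ^N} ‖h(x) − x‖ < δ, the Lebesgue measure of the symmetric difference (h(Ω) \ Ω) ∪ (Ω \ h(Ω)) is less than ε. (This makes precise the paper's repeatedly used facts |Ω_h \ Ω_0| → 0 and |Ω_0 \ Ω_h| → 0 as h → id.) -/

import Mathlib

open MeasureTheory

/-- Uniform interpolation formula: values at `1` of polynomials of degree at most `n` are
a fixed affine combination of values at points in `(0, η)`. -/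
lemma aux_interp (n : ℕ) (η : ℝ) (hη : 0 < η) :
    ∃ (v : ℕ → ℝ) (c : ℕ → ℝ), (∀ i ∈ Finset.range (n + 1), 0 < v i ∧ v i < η) ∧
      ∑ i ∈ Finset.range (n + 1), c i = 1 ∧
      ∀ p : Polynomial ℝ, p.natDegree ≤ n →
        p.eval 1 = ∑ i ∈ Finset.range (n + 1), c i * p.eval (v i) := by
  let v : ℕ → ℝ := fun i => η / (i + 2)
  have hv : Set.InjOn v (Finset.range (n + 1) : Finset ℕ) := by
    intro i _ j _ hij
    have h1 : ((i : ℝ) + 2) ≠ 0 := by positivity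
    have h2 : ((j : ℝ) + 2) ≠ 0 := by positivity
    have : η / ((i : ℝ) + 2) = η / ((j : ℝ) + 2) := hij
    rw [div_eq_div_iff h1 h2] at this
    have := mul_left_cancel₀ hη.ne' this
    have : (i : ℝ) = j := by linarith
    exact_mod_cast this
  refine ⟨v, fun i => (Lagrange.basis (Finset.range (n + 1)) v i).eval 1, ?_, ?_, ?_⟩
  · intro i _
    refine ⟨by positivity, ?_⟩
    have : (0 : ℝ) ≤ i := Nat.cast_nonneg i
    rw [div_lt_iff₀ (by positivity)]
    nlinarith
  · rw [← Polynomial.eval_finsetSum, Lagrange.sum_basis hv (by simp)]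
    simp
  · intro p hp
    have hd : p.degree < (Finset.range (n + 1)).card := by
      rw [Finset.card_range]
      exact lt_of_le_of_lt Polynomial.degree_le_natDegree (by exact_mod_cast Nat.lt_succ_of_le hp)
    conv_lhs => rw [Lagrange.eq_interpolate hv hd]
    rw [Lagrange.interpolate_apply, Polynomial.eval_finsetSum]
    refine Finset.sum_congr rfl fun i _ => ?_
    rw [Polynomial.eval_mul, Polynomial.eval_C, mul_comm]

/-- The integrand is a polynomial in `t` of degree at most `2 k + N`. -/
lemma aux_poly (N k : ℕ) (M : ℝ) (u w : EuclideanSpace ℝ (Fin N))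
    (A : EuclideanSpace ℝ (Fin N) →L[ℝ] EuclideanSpace ℝ (Fin N)) :
    ∃ p : Polynomial ℝ, p.natDegree ≤ 2 * k + N ∧
      ∀ t : ℝ, p.eval t =
        (1 - ‖u + t • w‖ ^ 2 / M) ^ k * (ContinuousLinearMap.id ℝ _ + t • A).det := by
  let b := (EuclideanSpace.basisFun (Fin N) ℝ).toBasis
  let B := LinearMap.toMatrix b b (A : EuclideanSpace ℝ (Fin N) →ₗ[ℝ] EuclideanSpace ℝ (Fin N))
  let q : Polynomial ℝ := Polynomial.C (1 - ‖u‖ ^ 2 / M)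
    + Polynomial.C (- (2 * inner ℝ u w) / M) * Polynomial.X
    + Polynomial.C (- ‖w‖ ^ 2 / M) * Polynomial.X ^ 2
  let d : Polynomial ℝ := Matrix.det ((Polynomial.X : Polynomial ℝ) • B.map Polynomial.C
    + (1 : Matrix (Fin N) (Fin N) ℝ).map Polynomial.C)
  refine ⟨q ^ k * d, ?_, fun t => ?_⟩
  · refine Polynomial.natDegree_mul_le.trans ?_
    have h1 : (q ^ k).natDegree ≤ 2 * k := by
      refine Polynomial.natDegree_pow_le.trans ?_
      have : q.natDegree ≤ 2 := by
        simp only [q]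
        compute_degree
      nlinarith
    have h2 : d.natDegree ≤ N := by
      have := Polynomial.natDegree_det_X_add_C_le B (1 : Matrix (Fin N) (Fin N) ℝ)
      rwa [Fintype.card_fin] at this
    omega
  · rw [Polynomial.eval_mul, Polynomial.eval_pow]
    congr 1
    · congr 1
      simp only [q, Polynomial.eval_add, Polynomial.eval_mul, Polynomial.eval_C,
        Polynomial.eval_X, Polynomial.eval_pow]
      rw [norm_add_sq_real, inner_smul_right, norm_smul, mul_pow, Real.norm_eq_abs, sq_abs]
      ring
    · have h1 : (ContinuousLinearMap.id ℝ _ + t • A).det = Matrix.det (1 + t • B) := by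
        rw [ContinuousLinearMap.det, ← LinearMap.det_toMatrix b]
        congr 1
        simp only [B]
        rw [← map_smul, ← LinearMap.toMatrix_one b, ← map_add]
        rfl
      rw [h1]
      simp only [d]
      rw [← Polynomial.coe_evalRingHom, RingHom.map_det]
      congr 1
      ext i j
      by_cases hij : i = j
      · simp [Matrix.one_apply, hij]
        ring
      · simp [Matrix.one_apply, hij]
        ring

/-- For small `t`, the change of variables formula. -/
lemma aux_small {N : ℕ} (g : EuclideanSpace ℝ (Fin N) → EuclideanSpace ℝ (Fin N))
    (hg : ContDiff ℝ 1 g) (hgs : HasCompactSupport g) :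
    ∃ η : ℝ, 0 < η ∧ ∀ R : ℝ, tsupport g ⊆ Metric.closedBall 0 R → ∀ t : ℝ, 0 < t → t < η →
      ∀ φ : EuclideanSpace ℝ (Fin N) → ℝ,
      ∫ x in Metric.closedBall 0 R,
        φ (x + t • g x) * (ContinuousLinearMap.id ℝ _ + t • fderiv ℝ g x).det
        = ∫ x in Metric.closedBall 0 R, φ x := by
  obtain ⟨L, hL⟩ := hg.lipschitzWith_of_hasCompactSupport hgs (by simp)
  have hdet : ∃ r > 0, ∀ A : EuclideanSpace ℝ (Fin N) →L[ℝ] EuclideanSpace ℝ (Fin N),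
      ‖A‖ < r → 0 < (ContinuousLinearMap.id ℝ _ + A).det := by
    have hc : Continuous fun A : EuclideanSpace ℝ (Fin N) →L[ℝ] EuclideanSpace ℝ (Fin N) =>
        (ContinuousLinearMap.id ℝ _ + A).det :=
      ContinuousLinearMap.continuous_det.comp (continuous_const.add continuous_id)
    have h0 : 0 < (ContinuousLinearMap.id ℝ (EuclideanSpace ℝ (Fin N)) + 0).det := by
      rw [add_zero, ContinuousLinearMap.det]
      simp
    have := hc.continuousAt.eventually_const_lt h0
    obtain ⟨r, hr, h⟩ := Metric.eventually_nhds_iff.1 this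
    exact ⟨r, hr, fun A hA => h (by simpa using hA)⟩
  obtain ⟨r, hr, hdet⟩ := hdet
  refine ⟨min r 1 / (L + 1), by positivity, fun R hR t ht htη φ => ?_⟩
  have hL1 : (0 : ℝ) < L + 1 := by positivity
  rw [lt_div_iff₀ hL1] at htη
  have htr : t * (L + 1) < r := htη.trans_le (min_le_left _ _)
  have ht1 : t * (L + 1) < 1 := htη.trans_le (min_le_right _ _)
  set F : EuclideanSpace ℝ (Fin N) → EuclideanSpace ℝ (Fin N) := fun x => x + t • g x with hF
  have hgd : Differentiable ℝ g := hg.differentiable (by simp)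
  have happ : ApproximatesLinearOn F
      ((ContinuousLinearEquiv.refl ℝ (EuclideanSpace ℝ (Fin N)) :
        EuclideanSpace ℝ (Fin N) ≃L[ℝ] EuclideanSpace ℝ (Fin N)) :
        EuclideanSpace ℝ (Fin N) →L[ℝ] EuclideanSpace ℝ (Fin N)) Set.univ (Real.toNNReal t * L) := by
    rw [ApproximatesLinearOn]
    intro x _ y _
    have e : F x - F y - (x - y) = t • (g x - g y) := by
      simp only [hF]; rw [smul_sub]; abel
    have h1 := hL.dist_le_mul x y
    rw [dist_eq_norm, dist_eq_norm] at h1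
    simp only [ContinuousLinearEquiv.coe_coe, ContinuousLinearEquiv.refl_apply]
    rw [e, norm_smul, Real.norm_eq_abs, abs_of_pos ht]
    rw [NNReal.coe_mul, Real.coe_toNNReal t ht.le, mul_assoc]
    exact mul_le_mul_of_nonneg_left h1 ht.le
  have hc : Subsingleton (EuclideanSpace ℝ (Fin N)) ∨ (Real.toNNReal t * L : NNReal) <
      ‖(((ContinuousLinearEquiv.refl ℝ (EuclideanSpace ℝ (Fin N))).symm :
        EuclideanSpace ℝ (Fin N) ≃L[ℝ] EuclideanSpace ℝ (Fin N)) :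
        EuclideanSpace ℝ (Fin N) →L[ℝ] EuclideanSpace ℝ (Fin N))‖₊⁻¹ := by
    rcases subsingleton_or_nontrivial (EuclideanSpace ℝ (Fin N)) with h | h
    · exact Or.inl h
    · right
      have : ‖(((ContinuousLinearEquiv.refl ℝ (EuclideanSpace ℝ (Fin N))).symm :
        EuclideanSpace ℝ (Fin N) ≃L[ℝ] EuclideanSpace ℝ (Fin N)) :
        EuclideanSpace ℝ (Fin N) →L[ℝ] EuclideanSpace ℝ (Fin N))‖₊ = 1 := by
        simp
      rw [this, inv_one, ← NNReal.coe_lt_coe]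
      rw [NNReal.coe_mul, Real.coe_toNNReal t ht.le, NNReal.coe_one]
      nlinarith
  have hinj : Function.Injective F := Set.injOn_univ.1 (happ.injOn hc)
  have hsurj : Function.Surjective F := happ.surjective hc
  have hout : ∀ x, x ∉ Metric.closedBall (0 : EuclideanSpace ℝ (Fin N)) R → F x = x := by
    intro x hx
    have : g x = 0 := image_eq_zero_of_notMem_tsupport fun h => hx (hR h)
    simp [hF, this]
  have himg : F '' Metric.closedBall 0 R = Metric.closedBall 0 R := by
    ext z
    constructor
    · rintro ⟨x, hx, rfl⟩
      by_contra hz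
      have := hinj (hout _ hz)
      rw [this] at hz
      exact hz hx
    · intro hz
      obtain ⟨x, rfl⟩ := hsurj z
      refine ⟨x, ?_, rfl⟩
      by_contra hx
      rw [hout x hx] at hz
      exact hx hz
  have hcv := integral_image_eq_integral_abs_det_fderiv_smul volume
    (s := Metric.closedBall (0 : EuclideanSpace ℝ (Fin N)) R) (f := F)
    (f' := fun x => ContinuousLinearMap.id ℝ _ + t • fderiv ℝ g x)
    Metric.isClosed_closedBall.measurableSet
    (fun x _ => ((hasFDerivAt_id x).add ((hgd x).hasFDerivAt.const_smul t)).hasFDerivWithinAt)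
    hinj.injOn φ
  rw [himg] at hcv
  rw [hcv]
  refine integral_congr_ae (Filter.Eventually.of_forall fun x => ?_)
  have hpos : 0 < (ContinuousLinearMap.id ℝ _ + t • fderiv ℝ g x).det := by
    apply hdet
    rw [norm_smul, Real.norm_eq_abs, abs_of_pos ht]
    have := norm_fderiv_le_of_lipschitz ℝ hL (x₀ := x)
    nlinarith
  simp only [smul_eq_mul]
  rw [abs_of_pos hpos, mul_comm]

/-- The identity at `t = 1`. -/
lemma aux_one {N : ℕ} (g : EuclideanSpace ℝ (Fin N) → EuclideanSpace ℝ (Fin N))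
    (hg : ContDiff ℝ 1 g) (hgs : HasCompactSupport g) (R : ℝ)
    (hR : tsupport g ⊆ Metric.closedBall 0 R) (y : EuclideanSpace ℝ (Fin N)) (M : ℝ) (k : ℕ) :
    ∫ x in Metric.closedBall 0 R, (1 - ‖x + g x - y‖ ^ 2 / M) ^ k *
      (ContinuousLinearMap.id ℝ _ + fderiv ℝ g x).det
      = ∫ x in Metric.closedBall 0 R, (1 - ‖x - y‖ ^ 2 / M) ^ k := by
  obtain ⟨η, hη, hsm⟩ := aux_small g hg hgs
  obtain ⟨v, c, hv, hc, hp⟩ := aux_interp (2 * k + N) η hη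
  have hcont : ∀ t : ℝ, Continuous fun x => (1 - ‖x + t • g x - y‖ ^ 2 / M) ^ k *
      (ContinuousLinearMap.id ℝ _ + t • fderiv ℝ g x).det := by
    intro t
    have h1 : Continuous g := hg.continuous
    have h2 : Continuous (fderiv ℝ g) := hg.continuous_fderiv (by simp)
    have h3 : Continuous fun x => (ContinuousLinearMap.id ℝ _ + t • fderiv ℝ g x).det :=
      ContinuousLinearMap.continuous_det.comp (continuous_const.add (h2.const_smul t))
    fun_prop
  have key : ∀ x, (1 - ‖x + g x - y‖ ^ 2 / M) ^ k *
      (ContinuousLinearMap.id ℝ _ + fderiv ℝ g x).det =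
      ∑ i ∈ Finset.range (2 * k + N + 1), c i * ((1 - ‖x + v i • g x - y‖ ^ 2 / M) ^ k *
      (ContinuousLinearMap.id ℝ _ + v i • fderiv ℝ g x).det) := by
    intro x
    obtain ⟨p, hpd, hpe⟩ := aux_poly N k M (x - y) (g x) (fderiv ℝ g x)
    have := hp p hpd
    simp only [hpe, one_smul] at this
    simpa only [sub_add_eq_add_sub] using this
  simp only [key]
  rw [integral_finsetSum]
  · have : ∀ i ∈ Finset.range (2 * k + N + 1),
        ∫ x in Metric.closedBall 0 R, c i * ((1 - ‖x + v i • g x - y‖ ^ 2 / M) ^ k *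
        (ContinuousLinearMap.id ℝ _ + v i • fderiv ℝ g x).det)
        = c i * ∫ x in Metric.closedBall (0 : EuclideanSpace ℝ (Fin N)) R,
          (1 - ‖x - y‖ ^ 2 / M) ^ k := by
      intro i hi
      rw [integral_const_mul]
      rw [hsm R hR (v i) (hv i hi).1 (hv i hi).2 (fun z => (1 - ‖z - y‖ ^ 2 / M) ^ k)]
    rw [Finset.sum_congr rfl this, ← Finset.sum_mul, hc, one_mul]
  · intro i _
    exact ((hcont (v i)).continuousOn.integrableOn_compact
      (isCompact_closedBall _ _)).integrable.const_mul _

/-- A smooth compactly supported perturbation of the identity has dense range. -/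
lemma aux_dense {N : ℕ} (g : EuclideanSpace ℝ (Fin N) → EuclideanSpace ℝ (Fin N))
    (hg : ContDiff ℝ 1 g) (hgs : HasCompactSupport g) (y : EuclideanSpace ℝ (Fin N))
    (ρ : ℝ) (hρ : 0 < ρ) (hmiss : ∀ x, ρ ≤ ‖x + g x - y‖) : False := by
  obtain ⟨R₀, hR₀⟩ := hgs.isBounded.subset_closedBall (0 : EuclideanSpace ℝ (Fin N))
  set R := max R₀ (‖y‖ + ρ) with hRdef
  have hR : tsupport g ⊆ Metric.closedBall 0 R :=
    hR₀.trans (Metric.closedBall_subset_closedBall (le_max_left _ _))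
  have hg1 : Continuous g := hg.continuous
  have hg2 : Continuous (fderiv ℝ g) := hg.continuous_fderiv (by simp)
  have hd : Continuous fun x => (ContinuousLinearMap.id ℝ _ + fderiv ℝ g x).det :=
    ContinuousLinearMap.continuous_det.comp (continuous_const.add hg2)
  obtain ⟨M₁, hM₁⟩ := (isCompact_closedBall (0 : EuclideanSpace ℝ (Fin N)) R).exists_bound_of_continuousOn
    (f := fun x => x + g x - y) (by fun_prop)
  obtain ⟨M₂, hM₂⟩ := (isCompact_closedBall (0 : EuclideanSpace ℝ (Fin N)) R).exists_bound_of_continuousOn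
    (f := fun x => x - y) (by fun_prop)
  obtain ⟨D, hD⟩ := (isCompact_closedBall (0 : EuclideanSpace ℝ (Fin N)) R).exists_bound_of_continuousOn
    hd.continuousOn
  set M := max (max M₁ M₂) ρ with hM
  have hMρ : ρ ≤ M := le_max_right _ _
  have hM0 : 0 < M := hρ.trans_le hMρ
  have hM1 : M₁ ≤ M := (le_max_left _ _).trans (le_max_left _ _)
  have hM2 : M₂ ≤ M := (le_max_right _ _).trans (le_max_left _ _)
  set a := 1 - ρ ^ 2 / M ^ 2 with ha
  set b := 1 - (ρ / 2) ^ 2 / M ^ 2 with hb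
  have hab : a < b := by
    simp only [ha, hb]
    gcongr
    linarith
  have ha0 : 0 ≤ a := by
    simp only [ha, sub_nonneg]
    rw [div_le_one (by positivity)]
    gcongr
  have hb0 : 0 < b := ha0.trans_lt hab
  set V := volume.real (Metric.closedBall (0 : EuclideanSpace ℝ (Fin N)) R) with hV
  set W := volume.real (Metric.ball y (ρ / 2)) with hW
  have hW0 : 0 < W := by
    rw [hW, Measure.real, ENNReal.toReal_pos_iff]
    exact ⟨Metric.measure_ball_pos _ _ (by positivity), measure_ball_lt_top⟩
  have hsub : Metric.ball y (ρ / 2) ⊆ Metric.closedBall (0 : EuclideanSpace ℝ (Fin N)) R := by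
    intro z hz
    rw [Metric.mem_ball, dist_eq_norm] at hz
    rw [mem_closedBall_zero_iff]
    have : ‖z‖ ≤ ‖z - y‖ + ‖y‖ := by simpa using norm_add_le (z - y) y
    have := le_max_right R₀ (‖y‖ + ρ)
    linarith
  have hineq : ∀ k : ℕ, W * b ^ k ≤ D * V * a ^ k := by
    intro k
    have hint : IntegrableOn (fun x : EuclideanSpace ℝ (Fin N) => (1 - ‖x - y‖ ^ 2 / M ^ 2) ^ k)
        (Metric.closedBall 0 R) :=
      ContinuousOn.integrableOn_compact (isCompact_closedBall _ _) (by fun_prop)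
    calc W * b ^ k = ∫ x in Metric.ball y (ρ / 2), b ^ k := by
          rw [setIntegral_const, smul_eq_mul]
      _ ≤ ∫ x in Metric.ball y (ρ / 2), (1 - ‖x - y‖ ^ 2 / M ^ 2) ^ k := by
          refine setIntegral_mono_on ?_ (hint.mono_set hsub) measurableSet_ball ?_
          · exact integrableOn_const measure_ball_lt_top.ne
          · intro x hx
            rw [Metric.mem_ball, dist_eq_norm] at hx
            simp only [hb]
            gcongr
      _ ≤ ∫ x in Metric.closedBall 0 R, (1 - ‖x - y‖ ^ 2 / M ^ 2) ^ k := by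
          refine setIntegral_mono_set hint ?_ hsub.eventuallyLE
          refine (ae_restrict_iff' Metric.isClosed_closedBall.measurableSet).2
            (Filter.Eventually.of_forall fun x hx => ?_)
          apply pow_nonneg
          rw [sub_nonneg, div_le_one (by positivity)]
          have := (hM₂ x hx).trans hM2
          gcongr
      _ = ∫ x in Metric.closedBall 0 R, (1 - ‖x + g x - y‖ ^ 2 / M ^ 2) ^ k *
            (ContinuousLinearMap.id ℝ _ + fderiv ℝ g x).det :=
          (aux_one g hg hgs R hR y (M ^ 2) k).symm
      _ ≤ ‖∫ x in Metric.closedBall 0 R, (1 - ‖x + g x - y‖ ^ 2 / M ^ 2) ^ k *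
            (ContinuousLinearMap.id ℝ _ + fderiv ℝ g x).det‖ := Real.le_norm_self _
      _ ≤ (a ^ k * D) * V := by
          refine norm_setIntegral_le_of_norm_le_const
            (isCompact_closedBall _ _).measure_lt_top fun x hx => ?_
          rw [norm_mul, norm_pow]
          have h0 : 0 ≤ 1 - ‖x + g x - y‖ ^ 2 / M ^ 2 := by
            rw [sub_nonneg, div_le_one (by positivity)]
            have := (hM₁ x hx).trans hM1
            gcongr
          have h1 : ‖1 - ‖x + g x - y‖ ^ 2 / M ^ 2‖ ≤ a := by
            rw [Real.norm_of_nonneg h0]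
            simp only [ha]
            have := hmiss x
            gcongr
          have h2 := hD x hx
          gcongr
      _ = D * V * a ^ k := by ring
  have hlim : Filter.Tendsto (fun k : ℕ => D * V * (a / b) ^ k) Filter.atTop (nhds (D * V * 0)) :=
    (tendsto_pow_atTop_nhds_zero_of_lt_one (by positivity) ((div_lt_one hb0).2 hab)).const_mul _
  rw [mul_zero] at hlim
  have := ge_of_tendsto' hlim (b := W) fun k => by
    rw [div_pow, mul_div_assoc', le_div_iff₀ (by positivity)]
    exact hineq k
  linarith

/-- Points of the center of a ball are attained by maps close to the identity. -/
lemma aux_brouwer {N : ℕ} (h : EuclideanSpace ℝ (Fin N) → EuclideanSpace ℝ (Fin N))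
    (hc : Continuous h) (δ : ℝ) (hδ : 0 < δ) (hh : ∀ x, ‖h x - x‖ < δ)
    (y : EuclideanSpace ℝ (Fin N)) : ∃ x ∈ Metric.closedBall y (2 * δ), h x = y := by
  by_contra hcon
  push Not at hcon
  have hK : IsCompact (h '' Metric.closedBall y (2 * δ)) := (isCompact_closedBall _ _).image hc
  have hy : y ∉ h '' Metric.closedBall y (2 * δ) := by
    rintro ⟨x, hx, hxy⟩
    exact hcon x hx hxy
  obtain ⟨ρ, hρ, hρK⟩ := Metric.isOpen_iff.1 hK.isClosed.isOpen_compl y hy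
  have hfar : ∀ x ∈ Metric.closedBall y (2 * δ), ρ ≤ ‖h x - y‖ := by
    intro x hx
    by_contra hlt
    push Not at hlt
    exact hρK (by rwa [Metric.mem_ball, dist_eq_norm]) ⟨x, hx, rfl⟩
  let χ : ContDiffBump y := ⟨2 * δ, 3 * δ, by positivity, by linarith⟩
  let f : EuclideanSpace ℝ (Fin N) → EuclideanSpace ℝ (Fin N) := fun x => χ x • (h x - x)
  have hfc : Continuous f := χ.continuous.smul (hc.sub continuous_id)
  set e := min (ρ / 2) (δ / 2) with he
  have he0 : 0 < e := by positivity
  have he1 : e ≤ ρ / 2 := min_le_left _ _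
  have he2 : e ≤ δ / 2 := min_le_right _ _
  obtain ⟨g, hg, hgf, hgs⟩ := hfc.exists_contDiff_approx 1 (ε := fun _ => e)
    continuous_const (fun _ => he0)
  have hfs : HasCompactSupport f := χ.hasCompactSupport.smul_right
  have hgcs : HasCompactSupport g := hfs.mono hgs
  refine aux_dense g (by exact_mod_cast hg) hgcs y e he0 fun x => ?_
  have h1 := hgf x
  rw [dist_eq_norm] at h1
  by_cases hx : x ∈ Metric.closedBall y (2 * δ)
  · have h2 : χ x = 1 := χ.one_of_mem_closedBall hx
    have h3 := hfar x hx
    have h4 : f x = h x - x := by simp [f, h2]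
    rw [h4] at h1
    have h5 : h x - y = (x + g x - y) - (g x - (h x - x)) := by abel
    have := norm_sub_le (x + g x - y) (g x - (h x - x))
    rw [← h5] at this
    linarith
  · rw [Metric.mem_closedBall, dist_eq_norm] at hx
    push Not at hx
    have h2 : ‖f x‖ ≤ δ := by
      simp only [f]
      rw [norm_smul, Real.norm_of_nonneg χ.nonneg]
      have := χ.le_one (x := x)
      have := χ.nonneg (x := x)
      have := hh x
      nlinarith [norm_nonneg (h x - x)]
    have h5 : x - y = (x + g x - y) - ((g x - f x) + f x) := by abel
    have h6 := norm_sub_le (x + g x - y) ((g x - f x) + f x)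
    rw [← h5] at h6
    have h7 := norm_add_le (g x - f x) (f x)
    linarith

lemma aux_frontier {N : ℕ} (Ω : Set (EuclideanSpace ℝ (Fin N)))
    (a b z : EuclideanSpace ℝ (Fin N)) (ha : a ∈ Ω) (hb : b ∉ Ω) (r : ℝ)
    (hz : z = a ∨ z = b) (hab : dist a b ≤ r) : z ∈ Metric.cthickening r (frontier Ω) := by
  have hex : ∃ w ∈ segment ℝ a b, w ∈ frontier Ω := by
    by_contra hcon
    push Not at hcon
    have hpre : IsPreconnected (segment ℝ a b) := (convex_segment a b).isPreconnected
    have hcov : segment ℝ a b ⊆ interior Ω ∪ (closure Ω)ᶜ := by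
      intro w hw
      by_cases h1 : w ∈ interior Ω
      · exact Or.inl h1
      · exact Or.inr fun h2 => hcon w hw ⟨h2, h1⟩
    have hsub := hpre.subset_left_of_subset_union isOpen_interior isClosed_closure.isOpen_compl
      (Set.disjoint_left.2 fun w h1 h2 => h2 (subset_closure (interior_subset h1))) hcov
      ⟨a, left_mem_segment ℝ a b, by
        rcases hcov (left_mem_segment ℝ a b) with h | h
        · exact h
        · exact absurd (subset_closure ha) h⟩
    exact hb (interior_subset (hsub (right_mem_segment ℝ a b)))
  obtain ⟨w, hw, hwf⟩ := hex
  have hd := dist_add_dist_of_mem_segment hw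
  refine Metric.mem_cthickening_of_dist_le z w r _ hwf ?_
  rcases hz with rfl | rfl
  · have := dist_nonneg (x := w) (y := b)
    linarith
  · have := dist_nonneg (x := a) (y := w)
    rw [dist_comm]
    linarith

/-- The facts `|Ω_h \ Ω_0| → 0` and `|Ω_0 \ Ω_h| → 0` as `h → id`, used repeatedly
in the paper. -/
theorem stmt10 (N : ℕ) (hN : 1 ≤ N)
    (Ω : Set (EuclideanSpace ℝ (Fin N))) (hΩopen : IsOpen Ω)
    (hΩbd : Bornology.IsBounded Ω) (hΩfr : volume (frontier Ω) = 0) :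
    ∀ ε : ℝ, 0 < ε → ∃ δ : ℝ, 0 < δ ∧
      ∀ h : EuclideanSpace ℝ (Fin N) → EuclideanSpace ℝ (Fin N),
        Continuous h → Function.Injective h → (∀ x, ‖h x - x‖ < δ) →
        volume ((h '' Ω \ Ω) ∪ (Ω \ h '' Ω)) < ENNReal.ofReal ε := by
  intro ε hε
  have hfb : Bornology.IsBounded (frontier Ω) := hΩbd.closure.subset frontier_subset_closure
  have ht := tendsto_measure_cthickening_of_isClosed (μ := volume) (s := frontier Ω)
    ⟨1, one_pos, hfb.cthickening.measure_lt_top.ne⟩ isClosed_frontier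
  rw [hΩfr] at ht
  have hev := ht.eventually_lt_const (ENNReal.ofReal_pos.2 hε)
  obtain ⟨r, hr, hlt⟩ := Metric.eventually_nhds_iff.1 hev
  refine ⟨r / 4, by positivity, fun h hc _ hh => ?_⟩
  refine (measure_mono ?_).trans_lt (hlt (y := r / 2) ?_)
  · rintro z (⟨⟨x, hx, rfl⟩, hz⟩ | ⟨hz, hzh⟩)
    · refine aux_frontier Ω x (h x) (h x) hx hz _ (Or.inr rfl) ?_
      rw [dist_comm, dist_eq_norm]
      linarith [hh x]
    · obtain ⟨x, hx, hxz⟩ := aux_brouwer h hc (r / 4) (by positivity) hh z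
      have hxΩ : x ∉ Ω := fun h1 => hzh ⟨x, h1, hxz⟩
      refine aux_frontier Ω z x z hz hxΩ _ (Or.inl rfl) ?_
      rw [Metric.mem_closedBall, dist_comm] at hx
      linarith
  · rw [Real.dist_eq, sub_zero, abs_of_pos (by positivity)]
    linarith
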